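/- arXiv:2506.18540 — 2 statements merged into one kernel-verified Lean document; each statement's English description precedes it below -/
import Mathlib

section
/- Fix a party q ∈ Fin 5 and let i be a bifurcation choice belonging to I_ch^q, i.e. the number of parties q' ≠ q with i_lost^{q'} = q equals exactly 3, and i_lost^{i_ch^q} = q. Then every voting configuration (v_ch, v_pr, l_ch, l_pr) compatible with i satisfies l_ch^k = [k = q] for every k ∈ Fin 5 and l_pr^k = 0 for every k ∈ Fin 5 (q is the chancellor and there is no president). -/
open Finset

/-- A voting configuration on 5 parties: binary chancellor/president votes
`vch q k`, `vpr q k` (vote of party `q` for party `k`; the diagonal is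
normalized to `0` since only pairs with `k ≠ q` carry a vote), and binary
labels `lch q` (is `q` chancellor?) and `lpr q` (is `q` president?). -/
structure Config where
  vch : Fin 5 → Fin 5 → ℕ
  vpr : Fin 5 → Fin 5 → ℕ
  lch : Fin 5 → ℕ
  lpr : Fin 5 → ℕ
  vch_le : ∀ q k, vch q k ≤ 1
  vpr_le : ∀ q k, vpr q k ≤ 1
  lch_le : ∀ q, lch q ≤ 1
  lpr_le : ∀ q, lpr q ≤ 1
  vch_diag : ∀ q, vch q q = 0
  vpr_diag : ∀ q, vpr q q = 0

/-- The constraints (i)–(iv) on a voting configuration. -/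
def Config.Satisfies (c : Config) : Prop :=
  (∀ q, ∑ k ∈ univ.filter (· ≠ q), c.vch q k ≤ 1) ∧
  (∀ q, ∑ k ∈ univ.filter (· ≠ q), c.vpr q k ≤ c.lch q) ∧
  (∀ q, (c.lch q = 1 ↔ 3 ≤ ∑ k ∈ univ.filter (· ≠ q), c.vch k q)) ∧
  (∀ q, c.lpr q = ∑ k ∈ univ.filter (· ≠ q),
      c.vpr k q *
        (if 3 ≤ ∑ q' ∈ univ.filter (fun x => x ≠ k ∧ x ≠ q), c.vch q' k then 1 else 0))

/-- A bifurcation choice: for each party `q`, a party `ilost q ≠ q`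
(its chancellor vote if it lost) and a party `ich q ≠ q`
(its president vote if it is chancellor). -/
structure Bif where
  ilost : Fin 5 → Fin 5
  ich : Fin 5 → Fin 5
  ilost_ne : ∀ q, ilost q ≠ q
  ich_ne : ∀ q, ich q ≠ q

/-- Compatibility of a voting configuration with a bifurcation choice. -/
def Compatible (c : Config) (i : Bif) : Prop :=
  c.Satisfies ∧
  (∀ q, ¬ (c.lch q = 1 ∧ c.lpr q = 1)) ∧
  (∀ q k, k ≠ q →
    ((c.lch q = 0 ∧ c.lpr q = 0) →
      c.vch q k = (if k = i.ilost q then 1 else 0) ∧ c.vpr q k = 0) ∧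
    ((c.lch q = 1 ∧ c.lpr q = 0) →
      c.vch q k = 0 ∧ c.vpr q k = (if k = i.ich q then 1 else 0)) ∧
    ((c.lch q = 0 ∧ c.lpr q = 1) →
      c.vch q k = 0 ∧ c.vpr q k = 0))

/-- `I_lost`: every party receives strictly fewer than 3 lost-votes. -/
def ILost (i : Bif) : Prop :=
  ∀ q : Fin 5, (univ.filter (fun q' => q' ≠ q ∧ i.ilost q' = q)).card < 3

/-- `I_ch^q`: exactly 3 parties lost-vote for `q`, and the party `q` would
president-vote for lost-votes for `q`. -/
def ICh (q : Fin 5) (i : Bif) : Prop :=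
  (univ.filter (fun q' => q' ≠ q ∧ i.ilost q' = q)).card = 3 ∧ i.ilost (i.ich q) = q

/-- `I_pr^{q,q'}`: at least 3 parties outside `{q, q'}` lost-vote for `q`,
and `q` would president-vote for `q'`. -/
def IPr (q q' : Fin 5) (i : Bif) : Prop :=
  3 ≤ (univ.filter (fun k => k ≠ q ∧ k ≠ q' ∧ i.ilost k = q)).card ∧ i.ich q = q'

/-- Every chancellor vote in a compatible configuration is a lost-vote. -/
theorem Compatible.vch_le_ilost {c : Config} {i : Bif} (hc : Compatible c i)
    {x k : Fin 5} (hxk : x ≠ k) : c.vch x k ≤ if i.ilost x = k then 1 else 0 := by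
  obtain ⟨-, hne, hcomp⟩ := hc
  obtain ⟨h00, h10, h01⟩ := hcomp x k hxk.symm
  have hne := hne x
  have hch := c.lch_le x
  have hpr := c.lpr_le x
  grind

/-- The chancellor votes for `k` from a set of other parties are at most the lost-votes for `k`
from that set. -/
theorem Compatible.sum_vch_le_card {c : Config} {i : Bif} (hc : Compatible c i)
    {s : Finset (Fin 5)} {k : Fin 5} (hs : k ∉ s) :
    ∑ x ∈ s, c.vch x k ≤ (s.filter (fun x => i.ilost x = k)).card := by
  rw [card_filter]
  exact sum_le_sum fun x hx => hc.vch_le_ilost (ne_of_mem_of_not_mem hx hs)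

/-- At most one party receives three or more lost-votes. -/
theorem Bif.eq_of_three_le_card {i : Bif} {q k : Fin 5}
    (hq : 3 ≤ (univ.filter (fun x => x ≠ q ∧ i.ilost x = q)).card)
    (hk : 3 ≤ (univ.filter (fun x => x ≠ k ∧ i.ilost x = k)).card) : k = q := by
  by_contra hkq
  have hdisj : Disjoint (univ.filter (fun x => x ≠ q ∧ i.ilost x = q))
      (univ.filter (fun x => x ≠ k ∧ i.ilost x = k)) :=
    disjoint_filter.2 fun x _ h h' => hkq (h'.2.symm.trans h.2)
  have hcard := card_le_univ
    (univ.filter (fun x => x ≠ q ∧ i.ilost x = q) ∪ univ.filter (fun x => x ≠ k ∧ i.ilost x = k))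
  rw [card_union_of_disjoint hdisj, Fintype.card_fin] at hcard
  omega

/-- A chancellor receives at least three lost-votes. -/
theorem Compatible.three_le_card_of_lch {c : Config} {i : Bif} (hc : Compatible c i)
    {k : Fin 5} (hk : c.lch k = 1) :
    3 ≤ (univ.filter (fun x => x ≠ k ∧ i.ilost x = k)).card := by
  have hsum := (hc.1.2.2.1 k).1 hk
  have hle := hc.sum_vch_le_card (s := univ.filter (· ≠ k)) (k := k) (by simp)
  rw [filter_filter] at hle
  exact hsum.trans hle

/-- A president is chosen by a chancellor who has three lost-votes from the remaining parties. -/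
theorem Compatible.exists_iPr_of_lpr_ne_zero {c : Config} {i : Bif} (hc : Compatible c i)
    {p : Fin 5} (hp : c.lpr p ≠ 0) : ∃ k, IPr k p i := by
  rw [hc.1.2.2.2 p] at hp
  obtain ⟨k, hk, hkp⟩ := exists_ne_zero_of_sum_ne_zero hp
  have hkp_ne : k ≠ p := (mem_filter.1 hk).2
  obtain ⟨hv, hif⟩ := mul_ne_zero_iff.1 hkp
  have hsum := (ite_ne_right_iff.1 hif).1
  have hle := hc.sum_vch_le_card (s := univ.filter (fun x => x ≠ k ∧ x ≠ p)) (k := k) (by simp)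
  rw [filter_filter] at hle
  refine ⟨k, by simpa only [and_assoc] using hsum.trans hle, ?_⟩
  obtain ⟨h00, h10, h01⟩ := hc.2.2 k p hkp_ne.symm
  have hne := hc.2.1 k
  have hch := c.lch_le k
  have hpr := c.lpr_le k
  grind

/-- The classes `ICh q` and `IPr k p` are disjoint. -/
theorem ICh.not_iPr {q k p : Fin 5} {i : Bif} (hi : ICh q i) : ¬ IPr k p i := by
  rintro ⟨hcard, rfl⟩
  have hsub : univ.filter (fun x => x ≠ k ∧ x ≠ i.ich k ∧ i.ilost x = k) ⊆
      univ.filter (fun x => x ≠ k ∧ i.ilost x = k) :=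
    monotone_filter_right _ fun x _ h => ⟨h.1, h.2.2⟩
  obtain rfl := Bif.eq_of_three_le_card hi.1.ge (hcard.trans (card_le_card hsub))
  have hlt := card_lt_card (hsub.ssubset_of_mem_notMem
    (a := i.ich k) (by simp [hi.2, i.ich_ne]) (by simp))
  have := hi.1
  omega

/-- If the bifurcation choice lies in I_ch^q, then in any compatible
configuration, q is the chancellor and there is no president. -/
theorem ICh_chancellor_no_president (q : Fin 5) (i : Bif) (hi : ICh q i)
    (c : Config) (hc : Compatible c i) :
    (∀ k : Fin 5, c.lch k = (if k = q then 1 else 0)) ∧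
    (∀ k : Fin 5, c.lpr k = 0) := by
  have hpr : ∀ p, c.lpr p = 0 := fun p => by
    by_contra hp
    obtain ⟨k, hk⟩ := hc.exists_iPr_of_lpr_ne_zero hp
    exact hi.not_iPr hk
  have huniq : ∀ k, c.lch k = 1 → k = q := fun k hk =>
    Bif.eq_of_three_le_card hi.1.ge (hc.three_le_card_of_lch hk)
  have hzero : ∀ k, k ≠ q → c.lch k = 0 := fun k hk => by
    have := c.lch_le k
    have := mt (huniq k) hk
    omega
  refine ⟨fun k => ?_, hpr⟩
  split_ifs with hk
  · subst hk
    rw [hc.1.2.2.1 k, ← hi.1, ← filter_filter, card_filter]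
    refine sum_le_sum fun x hx => ?_
    have hxk : x ≠ k := (mem_filter.1 hx).2
    rw [((hc.2.2 x k hxk.symm).1 ⟨hzero x hxk, hpr x⟩).1]
    simp only [eq_comm, le_refl]
  · exact hzero k hk
end

section
/- Fix distinct parties q, q' ∈ Fin 5 and let i be a bifurcation choice belonging to I_pr^{q,q'}, i.e. the number of parties k ∉ {q, q'} with i_lost^k = q is at least 3, and i_ch^q = q'. Then there exists exactly one voting configuration compatible with i. -/
open Finset

/-- The configuration in which `q` is chancellor and votes for the president `q'`, while
every other party has lost and votes for `q`. -/
def Config.ofWinners (q q' : Fin 5) (hqq : q ≠ q') : Config where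
  vch x k := if x ≠ q ∧ x ≠ q' ∧ k = q then 1 else 0
  vpr x k := if x = q ∧ k = q' then 1 else 0
  lch x := if x = q then 1 else 0
  lpr x := if x = q' then 1 else 0
  vch_le _ _ := by split_ifs <;> simp
  vpr_le _ _ := by split_ifs <;> simp
  lch_le _ := by split_ifs <;> simp
  lpr_le _ := by split_ifs <;> simp
  vch_diag x := if_neg fun h => h.1 h.2.2
  vpr_diag _ := if_neg fun h => hqq (h.1.symm.trans h.2)

theorem Config.ofWinners_satisfies (q q' : Fin 5) (hqq : q ≠ q') :
    (Config.ofWinners q q' hqq).Satisfies := by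
  revert q q'
  unfold Config.Satisfies Config.ofWinners
  decide +kernel

theorem Config.ext_fields {c d : Config} (hvch : ∀ x k, c.vch x k = d.vch x k)
    (hvpr : ∀ x k, c.vpr x k = d.vpr x k) (hlch : ∀ x, c.lch x = d.lch x)
    (hlpr : ∀ x, c.lpr x = d.lpr x) : c = d := by
  cases c
  cases d
  congr
  · exact funext₂ hvch
  · exact funext₂ hvpr
  · exact funext hlch
  · exact funext hlpr

/-- Three parties avoiding `q` and `q'` are all the parties avoiding `q` and `q'`. -/
theorem IPr.ilost_eq {q q' : Fin 5} {i : Bif} (hqq : q ≠ q') (hi : IPr q q' i) {k : Fin 5}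
    (hkq : k ≠ q) (hkq' : k ≠ q') : i.ilost k = q := by
  have hcard : #{x : Fin 5 | x ≠ q ∧ x ≠ q'} = 3 := by
    clear hi hkq hkq'
    revert q q'
    decide
  have hsub : ({x | x ≠ q ∧ x ≠ q' ∧ i.ilost x = q} : Finset (Fin 5)) ⊆
      ({x | x ≠ q ∧ x ≠ q'} : Finset (Fin 5)) := by
    intro x
    simp only [mem_filter_univ]
    tauto
  have hmem : k ∈ ({x | x ≠ q ∧ x ≠ q'} : Finset (Fin 5)) := by simp [hkq, hkq']
  rw [← eq_of_subset_of_card_le hsub (hcard.trans_le hi.1)] at hmem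
  exact (mem_filter.1 hmem).2.2.2

theorem Config.ofWinners_compatible {q q' : Fin 5} (hqq : q ≠ q') {i : Bif} (hi : IPr q q' i) :
    Compatible (Config.ofWinners q q' hqq) i := by
  refine ⟨Config.ofWinners_satisfies q q' hqq, fun x => ?_, fun x k _ => ?_⟩
  · simp only [Config.ofWinners]
    grind
  · have hlost := hi.ilost_eq hqq (k := x)
    have hch := hi.2
    simp only [Config.ofWinners]
    grind

/-- Only a party that has lost casts a chancellor vote, and it votes according to `ilost`. -/
theorem Compatible.vch_eq_zero {c : Config} {i : Bif} (h : Compatible c i) {x k : Fin 5}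
    (hk : i.ilost x ≠ k) : c.vch x k = 0 := by
  obtain rfl | hkx := eq_or_ne k x
  · exact c.vch_diag k
  have h₁ := h.2.1 x
  have h₂ := h.2.2 x k hkx
  have h₃ := c.lch_le x
  have h₄ := c.lpr_le x
  grind

theorem Compatible.vpr_le_lch {c : Config} {i : Bif} (h : Compatible c i) (x k : Fin 5) :
    c.vpr x k ≤ c.lch x := by
  obtain rfl | hkx := eq_or_ne k x
  · simp [c.vpr_diag]
  exact (single_le_sum (f := c.vpr x) (fun _ _ => Nat.zero_le _) (by simpa using hkx)).trans
    (h.1.2.1 x)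

/-- A president must have been voted for by a chancellor. -/
theorem Compatible.lpr_eq_zero {c : Config} {i : Bif} (h : Compatible c i) {k : Fin 5}
    (hk : ∀ x, c.vpr x k = 0) : c.lpr k = 0 := by
  rw [h.1.2.2.2 k]
  simp [hk]

theorem Compatible.lch_eq_zero {c : Config} {i : Bif} (h : Compatible c i) {q q' : Fin 5}
    (hqq : q ≠ q') (hi : IPr q q' i) {p : Fin 5} (hp : p ≠ q) : c.lch p = 0 := by
  by_contra hne
  have hone : c.lch p = 1 := by
    have := c.lch_le p
    omega
  have hsum := (h.1.2.2.1 p).1 hone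
  have hle : ∑ k with k ≠ p, c.vch k p ≤ ∑ k ∈ {q, q'}, c.vch k p := by
    refine sum_le_sum_of_ne_zero fun k _ hk => ?_
    by_contra hmem
    simp only [mem_insert, mem_singleton, not_or] at hmem
    exact hk (h.vch_eq_zero (by rw [hi.ilost_eq hqq hmem.1 hmem.2]; exact hp.symm))
  rw [sum_pair hqq] at hle
  have h₁ := c.vch_le q p
  have h₂ := c.vch_le q' p
  omega

theorem Compatible.eq_ofWinners {c : Config} {i : Bif} (h : Compatible c i) {q q' : Fin 5}
    (hqq : q ≠ q') (hi : IPr q q' i) : c = Config.ofWinners q q' hqq := by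
  have hlch : ∀ p, p ≠ q → c.lch p = 0 := fun p hp => h.lch_eq_zero hqq hi hp
  have hvpr : ∀ x k, x ≠ q → c.vpr x k = 0 := fun x k hx => by
    have := h.vpr_le_lch x k
    have := hlch x hx
    omega
  have hlpr_q : c.lpr q = 0 := h.lpr_eq_zero fun x => by
    obtain rfl | hx := eq_or_ne x q
    · exact c.vpr_diag x
    · exact hvpr x q hx
  have hvpr_q : ∀ k, k ≠ q' → c.vpr q k = 0 := fun k hk => by
    obtain rfl | hkq := eq_or_ne k q
    · exact c.vpr_diag k
    have h₁ := h.vpr_le_lch q k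
    have h₂ := (h.2.2 q k hkq).2.1
    have h₃ := c.lch_le q
    have h₄ := hi.2
    grind
  have hlpr : ∀ k, k ≠ q' → c.lpr k = 0 := fun k hk => h.lpr_eq_zero fun x => by
    obtain rfl | hx := eq_or_ne x q
    · exact hvpr_q k hk
    · exact hvpr x k hx
  have hvch : ∀ x, x ≠ q → x ≠ q' → c.vch x q = 1 := fun x hx hx' => by
    rw [((h.2.2 x q hx.symm).1 ⟨hlch x hx, hlpr x hx'⟩).1, if_pos (hi.ilost_eq hqq hx hx').symm]
  have hvotes : 3 ≤ ∑ x with x ≠ q ∧ x ≠ q', c.vch x q := by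
    rw [sum_congr rfl fun x hx => hvch x (mem_filter.1 hx).2.1 (mem_filter.1 hx).2.2,
      ← card_eq_sum_ones]
    exact hi.1.trans (card_le_card fun x => by simp only [mem_filter_univ]; tauto)
  have hlch_q : c.lch q = 1 := (h.1.2.2.1 q).2 <| hvotes.trans <|
    sum_le_sum_of_subset fun x => by simp only [mem_filter_univ]; tauto
  have hvpr_qq' : c.vpr q q' = 1 := by
    rw [((h.2.2 q q' hqq.symm).2.1 ⟨hlch_q, hlpr_q⟩).2, if_pos hi.2.symm]
  have hlpr_q' : c.lpr q' = 1 := by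
    rw [h.1.2.2.2 q', sum_eq_single q (fun x _ hx => by simp [hvpr x q' hx])
      (fun hq => absurd (by simpa using hqq) hq), hvpr_qq', if_pos hvotes]
  refine Config.ext_fields (fun x k => ?_) (fun x k => ?_) (fun x => ?_) (fun x => ?_)
  · simp only [Config.ofWinners]
    have h₁ := c.vch_diag x
    have h₂ := h.2.2 x k
    have h₃ := hi.ilost_eq hqq (k := x)
    have h₄ := h.vch_eq_zero (x := x) (k := k)
    grind
  · simp only [Config.ofWinners]
    grind
  · simp only [Config.ofWinners]
    grind
  · simp only [Config.ofWinners]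
    grind

/-- If the bifurcation choice lies in I_pr^{q,q'}, there is exactly one
compatible configuration. -/
theorem IPr_unique_config (q q' : Fin 5) (hqq : q ≠ q')
    (i : Bif) (hi : IPr q q' i) :
    ∃! c : Config, Compatible c i := by
  exact ⟨Config.ofWinners q q' hqq, Config.ofWinners_compatible hqq hi,
    fun _ hc => Compatible.eq_ofWinners hc hqq hi⟩
end
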